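/- Let V be a finite-dimensional vector space over ℚ and μ : V × V → ℚ a nondegenerate alternating bilinear form. For every k ≥ 1, the bilinear form C'_k on the k-th exterior power Λ^k V determined by C'_k(a₁ ∧ ⋯ ∧ a_k, b₁ ∧ ⋯ ∧ b_k) = det(μ(a_i, b_j))_{1 ≤ i, j ≤ k} is nondegenerate. -/

import Mathlib

/-- The wedge `a₁ ∧ ⋯ ∧ a_k`, as an element of the `k`-th exterior power `⋀[ℚ]^k V`. -/
noncomputable def wedgeQ' {V : Type*} [AddCommGroup V] [Module ℚ V] (k : ℕ)
    (a : Fin k → V) : ⋀[ℚ]^k V :=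
  ⟨ExteriorAlgebra.ιMulti ℚ k a, ExteriorAlgebra.ιMulti_range ℚ k (Set.mem_range_self a)⟩

/-- A bilinear form on `⋀[R]^n M` given on wedges by the determinants of a bilinear form `B` on a
free module `M` is right-separating if every linear form on `M` is of the form `B a`. -/
lemma exteriorPower.separatingRight_of_det {R M : Type*} [CommRing R] [AddCommGroup M] [Module R M]
    [Module.Free R M] (n : ℕ) (B : M →ₗ[R] M →ₗ[R] R) (hB : Function.Surjective B)
    (C : (⋀[R]^n M) →ₗ[R] (⋀[R]^n M) →ₗ[R] R)
    (hC : ∀ a b : Fin n → M, C (ιMulti R n a) (ιMulti R n b) =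
      Matrix.det (Matrix.of fun i j => B (a i) (b j))) :
    C.SeparatingRight := by
  classical
  intro u hu
  obtain ⟨I, b⟩ := Module.Free.exists_basis R M
  let : LinearOrder I := linearOrderOfSTO WellOrderingRel
  choose d hd using fun i => hB (b.coord i)
  refine (b.exteriorPower n).ext_elem fun s => ?_
  have key : C (ιMulti R n (d ∘ Set.powersetCard.ofFinEmbEquiv.symm s)) = ιMultiDual R n b s := by
    ext v
    simp only [LinearMap.compAlternatingMap_apply, hC, ιMultiDual_apply_ιMulti,
      Function.comp_apply, hd]
    rw [← Matrix.det_transpose]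
    rfl
  rw [basis_repr_apply, ← key, hu, map_zero, Finsupp.zero_apply]

/-- Let `V` be a finite-dimensional `ℚ`-vector space and `μ` a nondegenerate alternating
bilinear form on `V`.  For every `k ≥ 1`, the bilinear form `C'_k` on `Λ^k V` determined
by `C'_k(a₁ ∧ ⋯ ∧ a_k, b₁ ∧ ⋯ ∧ b_k) = det(μ(a_i, b_j))` is nondegenerate. -/
theorem exteriorPower_form_nondegenerate (k : ℕ) (hk : 1 ≤ k)
    {V : Type*} [AddCommGroup V] [Module ℚ V] [FiniteDimensional ℚ V]
    (μ : V →ₗ[ℚ] V →ₗ[ℚ] ℚ)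
    (hμ_alt : ∀ a : V, μ a a = 0)
    (hμ_nondeg : ∀ a : V, (∀ b : V, μ a b = 0) → a = 0)
    (C' : (⋀[ℚ]^k V) →ₗ[ℚ] (⋀[ℚ]^k V) →ₗ[ℚ] ℚ)
    (hC' : ∀ a b : Fin k → V,
      C' (wedgeQ' k a) (wedgeQ' k b) = Matrix.det (Matrix.of fun i j => μ (a i) (b j))) :
    (∀ u : ⋀[ℚ]^k V, (∀ v : ⋀[ℚ]^k V, C' u v = 0) → u = 0) ∧
    (∀ u : ⋀[ℚ]^k V, (∀ v : ⋀[ℚ]^k V, C' v u = 0) → u = 0) := by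
  have hinj : Function.Injective μ := (injective_iff_map_eq_zero μ).2 fun a ha =>
    hμ_nondeg a fun b => by rw [ha, LinearMap.zero_apply]
  have halt : μ.IsAlt := hμ_alt
  have hinj_flip : Function.Injective μ.flip := (injective_iff_map_eq_zero μ.flip).2 fun a ha =>
    hμ_nondeg a fun b => by
      rw [← halt.neg, ← LinearMap.flip_apply, ha, LinearMap.zero_apply, neg_zero]
  have hdim : Module.finrank ℚ V = Module.finrank ℚ (Module.Dual ℚ V) :=
    Subspace.dual_finrank_eq.symm
  refine ⟨exteriorPower.separatingRight_of_det k μ.flip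
    ((LinearMap.injective_iff_surjective_of_finrank_eq_finrank hdim).1 hinj_flip) C'.flip
    fun a b => ?_, exteriorPower.separatingRight_of_det k μ
    ((LinearMap.injective_iff_surjective_of_finrank_eq_finrank hdim).1 hinj) C' hC'⟩
  rw [← Matrix.det_transpose]
  exact hC' b a
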